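/- Let v,w ∈ Δ⁺ be positive roots and let I' ⊆ I be any subset of vertices. Let v',w' ∈ ℕ^I be obtained from v,w by replacing all coordinates outside I' by 0. Then −⟨w',v'⟩ ≤ max(0, −⟨w,v⟩). -/

import Mathlib

noncomputable section

namespace ADEShuffle

/-- The Euler form of a quiver with vertex set `I`, arrow set `A`,
source map `s` and target map `t`. -/
def eulerForm {I A : Type} [Fintype I] [Fintype A] (s t : A → I) (v w : I → ℤ) : ℤ :=
  (∑ i, v i * w i) - ∑ a, v (s a) * w (t a)

/-- The real-coefficients Euler form. -/
def eulerFormR {I A : Type} [Fintype I] [Fintype A] (s t : A → I) (v w : I → ℝ) : ℝ :=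
  (∑ i, v i * w i) - ∑ a, v (s a) * w (t a)

/-- The Euler form evaluated on dimension vectors in `ℕ^I`. -/
def eulerN {I A : Type} [Fintype I] [Fintype A] (s t : A → I) (v w : I → ℕ) : ℤ :=
  eulerForm s t (fun i => (v i : ℤ)) (fun i => (w i : ℤ))

/-- Positive roots: nonzero `v ∈ ℕ^I` with `(v,v) = 2`, where `(v,w) = ⟨v,w⟩ + ⟨w,v⟩`
is the symmetrized Euler form. -/
def IsPosRoot {I A : Type} [Fintype I] [Fintype A] (s t : A → I) (v : I → ℕ) : Prop :=
  v ≠ 0 ∧ eulerN s t v v + eulerN s t v v = 2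

/-! ### Numerical part -/

section Num

set_option linter.unusedSectionVars false

variable {I A : Type} [Fintype I] [Fintype A] [DecidableEq I] {R : Type} [CommRing R]

/-- Euler form over any commutative ring. -/
def eu (s t : A → I) (v w : I → R) : R := (∑ i, v i * w i) - ∑ a, v (s a) * w (t a)

/-- Sources after reversing all arrows starting at `i`. -/
def rs (s t : A → I) (i : I) (a : A) : I := if s a = i then t a else s a

/-- Targets after reversing all arrows starting at `i`. -/
def rt (s t : A → I) (i : I) (a : A) : I := if s a = i then s a else t a

/-- Sum over the arrows starting at `i` of the target coordinates. -/
def PP (s t : A → I) (i : I) (w : I → R) : R := ∑ a, if s a = i then w (t a) else 0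

/-- Simple reflection at a source. -/
def sig (s t : A → I) (i : I) (v : I → R) : I → R := Function.update v i (PP s t i v - v i)

/-- The part of the Euler form away from `i`. -/
def RR (s t : A → I) (i : I) (v w : I → R) : R :=
  (∑ j, if j = i then 0 else v j * w j) - ∑ a, if s a = i then 0 else v (s a) * w (t a)

lemma sum_split (i : I) (f : I → R) : ∑ j, f j = (∑ j, if j = i then 0 else f j) + f i := by
  have : ∀ j, f j = (if j = i then 0 else f j) + (if j = i then f i else 0) := by
    intro j; split_ifs with h <;> simp [h]
  rw [Finset.sum_congr rfl (fun j _ => this j), Finset.sum_add_distrib]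
  simp

lemma eu_src (s t : A → I) (i : I) (v w : I → R) :
    eu s t v w = RR s t i v w + v i * w i - v i * PP s t i w := by
  unfold eu RR PP
  rw [sum_split i (fun j => v j * w j), Finset.mul_sum]
  have : ∑ a, v (s a) * w (t a) = (∑ a, if s a = i then 0 else v (s a) * w (t a)) +
      ∑ a, v i * (if s a = i then w (t a) else 0) := by
    rw [← Finset.sum_add_distrib]
    refine Finset.sum_congr rfl fun a _ => ?_
    split_ifs with h <;> simp [h]
  rw [this]; ring

lemma eu_refl (s t : A → I) (i : I) (v w : I → R) :
    eu (rs s t i) (rt s t i) v w = RR s t i v w + v i * w i - PP s t i v * w i := by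
  unfold eu RR PP
  rw [sum_split i (fun j => v j * w j), Finset.sum_mul]
  have : ∑ a, v (rs s t i a) * w (rt s t i a) =
      (∑ a, if s a = i then 0 else v (s a) * w (t a)) +
      ∑ a, (if s a = i then v (t a) else 0) * w i := by
    rw [← Finset.sum_add_distrib]
    refine Finset.sum_congr rfl fun a _ => ?_
    unfold rs rt
    split_ifs with h <;> simp [h]
  rw [this]; ring

lemma RR_congr {s t : A → I} {i : I} (hi : ∀ a, t a ≠ i) {v v' w w' : I → R}
    (hv : ∀ j, j ≠ i → v j = v' j) (hw : ∀ j, j ≠ i → w j = w' j) :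
    RR s t i v w = RR s t i v' w' := by
  unfold RR
  congr 1
  · refine Finset.sum_congr rfl fun j _ => ?_
    split_ifs with h
    · rfl
    · rw [hv j h, hw j h]
  · refine Finset.sum_congr rfl fun a _ => ?_
    split_ifs with h
    · rfl
    · rw [hv _ h, hw _ (hi a)]

lemma PP_congr {s t : A → I} {i : I} (hi : ∀ a, t a ≠ i) {v v' : I → R}
    (hv : ∀ j, j ≠ i → v j = v' j) : PP s t i v = PP s t i v' := by
  unfold PP
  exact Finset.sum_congr rfl fun a _ => by rw [hv _ (hi a)]

lemma sig_same (s t : A → I) (i : I) (v : I → R) : sig s t i v i = PP s t i v - v i := by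
  simp [sig]

lemma sig_ne (s t : A → I) (i : I) (v : I → R) {j : I} (h : j ≠ i) : sig s t i v j = v j := by
  simp [sig, h]

lemma PP_sig {s t : A → I} {i : I} (hi : ∀ a, t a ≠ i) (v : I → R) :
    PP s t i (sig s t i v) = PP s t i v :=
  PP_congr hi fun _ h => sig_ne _ _ _ _ h

lemma eu_sig {s t : A → I} {i : I} (hi : ∀ a, t a ≠ i) (v w : I → R) :
    eu (rs s t i) (rt s t i) (sig s t i v) (sig s t i w) = eu s t v w := by
  rw [eu_refl, eu_src s t i, PP_sig hi, sig_same, sig_same,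
    RR_congr hi (fun _ h => sig_ne s t i v h) (fun _ h => sig_ne s t i w h)]
  ring

/-- symmetrized form is orientation independent -/
lemma sy_refl (s t : A → I) (i : I) (v w : I → R) :
    eu (rs s t i) (rt s t i) v w + eu (rs s t i) (rt s t i) w v = eu s t v w + eu s t w v := by
  have : (∑ a, v (rs s t i a) * w (rt s t i a)) + (∑ a, w (rs s t i a) * v (rt s t i a)) =
      (∑ a, v (s a) * w (t a)) + ∑ a, w (s a) * v (t a) := by
    rw [← Finset.sum_add_distrib, ← Finset.sum_add_distrib]
    refine Finset.sum_congr rfl fun a _ => ?_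
    unfold rs rt
    split_ifs with h
    · ring
    · ring
  unfold eu
  linear_combination -this

lemma eu_single_left {s t : A → I} {i : I} (hi : ∀ a, t a ≠ i) (w : I → R) :
    eu s t (Pi.single i 1) w = w i - PP s t i w := by
  rw [eu_src s t i]
  have : RR s t i (Pi.single i 1) w = RR s t i 0 w :=
    RR_congr hi (fun j h => by simp [h]) (fun _ _ => rfl)
  rw [this]; simp [RR]

lemma eu_single_right {s t : A → I} {i : I} (hi : ∀ a, t a ≠ i) (w : I → R) :
    eu s t w (Pi.single i 1) = w i := by
  rw [eu_src s t i]
  have : RR s t i w (Pi.single i 1) = RR s t i w 0 :=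
    RR_congr hi (fun _ _ => rfl) (fun j h => by simp [h])
  have h2 : PP s t i (Pi.single i (1 : R)) = PP s t i (0 : I → R) :=
    PP_congr hi (fun j h => by simp [h])
  rw [this, h2]; simp [RR, PP]

lemma ell_step {s t : A → I} {i : I} (hi : ∀ a, t a ≠ i) (ρ v : I → R)
    (hρ : eu s t ρ (Pi.single i 1) + eu s t (Pi.single i 1) ρ = 1) :
    eu (rs s t i) (rt s t i) (sig s t i v) ρ = eu s t v ρ - v i := by
  rw [eu_single_left hi, eu_single_right hi] at hρ
  rw [eu_refl, eu_src s t i, PP_sig hi, sig_same,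
    RR_congr hi (fun _ h => sig_ne s t i v h) (fun _ _ => rfl)]
  linear_combination -(v i) * hρ

lemma rs_ne_rt {s t : A → I} (h : ∀ a, s a ≠ t a) (i : I) : ∀ a, rs s t i a ≠ rt s t i a := by
  intro a
  unfold rs rt
  split_ifs with h1
  · exact (h a).symm
  · exact h a

/-- A source exists in each nonempty vertex subset. -/
lemma exists_source {s t : A → I} (hpos : ∀ v : I → ℝ, v ≠ 0 → 0 < eu s t v v)
    (S : Finset I) (hS : S.Nonempty) : ∃ i ∈ S, ∀ a, s a ∈ S → t a ≠ i := by
  by_contra! hcon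
  have : Nonempty A := by
    obtain ⟨i, hi⟩ := hS
    exact ⟨(hcon i hi).choose⟩
  choose! f hf1 hf2 using hcon
  have hne : (fun j => if j ∈ S then (1 : ℝ) else 0) ≠ 0 := by
    obtain ⟨i, hi⟩ := hS
    intro h
    have := congrFun h i
    simp [hi] at this
  have h1 := hpos _ hne
  unfold eu at h1
  have h2 : (S.card : ℝ) ≤
      ∑ a, (if s a ∈ S then (1 : ℝ) else 0) * (if t a ∈ S then (1 : ℝ) else 0) := by
    have h3 : S.card ≤ (Finset.univ.filter fun a => s a ∈ S ∧ t a ∈ S).card := by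
      apply Finset.card_le_card_of_injOn f
      · intro i hi
        have hi' : i ∈ S := hi
        simp [hf1 i hi', hf2 i hi', hi']
      · intro i hi j hj hij
        rw [← hf2 i hi, ← hf2 j hj, hij]
    have h4 : ∑ a, (if s a ∈ S then (1 : ℝ) else 0) * (if t a ∈ S then (1 : ℝ) else 0) =
        ((Finset.univ.filter fun a => s a ∈ S ∧ t a ∈ S).card : ℝ) := by
      rw [Finset.card_filter]
      push_cast
      refine Finset.sum_congr rfl fun a _ => ?_
      by_cases h5 : s a ∈ S <;> by_cases h6 : t a ∈ S <;> simp [h5, h6]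
    rw [h4]; exact_mod_cast h3
  have h5 : ∑ i : I, (if i ∈ S then (1 : ℝ) else 0) * (if i ∈ S then (1 : ℝ) else 0) =
      (S.card : ℝ) := by
    simp
  simp only [h5] at h1
  linarith

/-- integral positive definiteness -/
lemma int_pos {s t : A → I} (hpos : ∀ v : I → ℝ, v ≠ 0 → 0 < eu s t v v)
    (v : I → ℤ) (hv : v ≠ 0) : 0 < eu s t v v := by
  have h := hpos (fun i => (v i : ℝ)) (by
    intro h; apply hv; funext i
    have := congrFun h i
    simpa using this)
  have : eu s t (fun i => (v i : ℝ)) (fun i => (v i : ℝ)) = ((eu s t v v : ℤ) : ℝ) := by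
    unfold eu; push_cast; rfl
  rw [this] at h
  exact_mod_cast h

/-- Positive roots remain positive under reflection, except the simple one. -/
lemma sig_nonneg {s t : A → I} (hpos : ∀ v : I → ℝ, v ≠ 0 → 0 < eu s t v v)
    {i : I} (hi : ∀ a, t a ≠ i) (v : I → ℤ) (hv : ∀ j, 0 ≤ v j) (h1 : eu s t v v = 1)
    (hne : v ≠ Pi.single i 1) : ∀ j, 0 ≤ sig s t i v j := by
  intro j
  by_cases hj : j = i
  swap
  · rw [sig_ne _ _ _ _ hj]; exact hv j
  subst hj
  by_contra! hneg
  rw [sig_same] at hneg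
  have hP : 0 ≤ PP s t j v := Finset.sum_nonneg fun a _ => by split_ifs <;> simp [hv]
  -- the remainder
  set r : I → ℤ := Function.update v j 0 with hr
  have hrr : eu s t r r = RR s t j v v := by
    rw [eu_src s t j, RR_congr hi (v' := v) (w' := v) (fun l h => by simp [hr, h])
      (fun l h => by simp [hr, h])]
    simp [hr]
  rw [eu_src s t j] at h1
  have hr0 : r = 0 := by
    by_contra h
    have := int_pos hpos r h
    rw [hrr] at this
    nlinarith [hv j]
  rw [← hrr, hr0] at h1
  have hP0 : PP s t j v = 0 := by
    rw [PP_congr hi (v' := r) (fun l h => by simp [hr, h]), hr0]; simp [PP]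
  rw [hP0] at h1
  have h2 : v j * v j = 1 := by simpa [eu] using h1
  have h3 : v j = 1 := by nlinarith [hv j]
  apply hne
  funext l
  by_cases hl : l = j
  · subst hl; simp [h3]
  · have := congrFun hr0 l
    simp [hr, hl] at this
    simp [hl, this]

/-- `L` is an admissible sequence of sources. -/
def Adm : List I → (A → I) → (A → I) → Prop
  | [], _, _ => True
  | i :: L, s, t => (∀ a, t a ≠ i) ∧ Adm L (rs s t i) (rt s t i)

/-- `v` becomes simple at some stage of the sequence. -/
def Dies : List I → (A → I) → (A → I) → (I → ℤ) → Prop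
  | [], _, _, _ => False
  | i :: L, s, t, v => v = Pi.single i 1 ∨ (0 ≤ v i ∧ Dies L (rs s t i) (rt s t i) (sig s t i v))

/-- The class of quivers we stay in. -/
structure Good (ρ : I → ℝ) (s t : A → I) : Prop where
  pos : ∀ v : I → ℝ, v ≠ 0 → 0 < eu s t v v
  rho : ∀ i, eu s t ρ (Pi.single i 1) + eu s t (Pi.single i 1) ρ = 1
  loop : ∀ a, s a ≠ t a

lemma Good.refl {ρ : I → ℝ} {s t : A → I} (h : Good ρ s t) (i : I) :
    Good ρ (rs s t i) (rt s t i) where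
  pos v hv := by
    have := sy_refl s t i v v
    have := h.pos v hv
    linarith
  rho j := by rw [sy_refl]; exact h.rho j
  loop := rs_ne_rt h.loop i

/-- The functional which decreases. -/
def ell (ρ : I → ℝ) (s t : A → I) (v : I → ℤ) : ℝ := eu s t (fun i => (v i : ℝ)) ρ

lemma ell_sig {ρ : I → ℝ} {s t : A → I} (h : Good ρ s t) {i : I} (hi : ∀ a, t a ≠ i)
    (v : I → ℤ) : ell ρ (rs s t i) (rt s t i) (sig s t i v) = ell ρ s t v - v i := by
  unfold ell
  rw [← ell_step hi ρ (fun i => (v i : ℝ)) (h.rho i)]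
  congr 1
  funext j
  unfold sig PP
  by_cases hj : j = i
  · subst hj; simp
  · simp [hj]

lemma cycle_step {ρ : I → ℝ} (P : (A → I) → (A → I) → Prop)
    (hP : ∀ s t i, P s t → P (rs s t i) (rt s t i)) (c : ℝ)
    (ih : ∀ s t : A → I, Good ρ s t → P s t → ∃ L, Adm L s t ∧ ∀ v : I → ℤ, (∀ j, 0 ≤ v j) →
      eu s t v v = 1 → ell ρ s t v ≤ c → Dies L s t v) :
    ∀ (n : ℕ) (S : Finset I), S.card = n → ∀ s t : A → I, Good ρ s t → P s t →
      (∀ a, t a ∈ S → s a ∈ S) →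
      ∃ L, Adm L s t ∧ ∀ v : I → ℤ, (∀ j, 0 ≤ v j) →
      eu s t v v = 1 → ell ρ s t v - ∑ i ∈ S, (v i : ℝ) ≤ c → Dies L s t v := by
  intro n
  induction n with
  | zero =>
    intro S hS s t hg hp _
    obtain rfl := Finset.card_eq_zero.mp hS
    simpa using ih s t hg hp
  | succ n ihn =>
    intro S hS s t hg hp hin
    obtain ⟨i, hiS, hi⟩ := exists_source hg.pos S (Finset.card_pos.mp (by omega))
    have hi' : ∀ a, t a ≠ i := fun a ha => hi a (hin a (ha ▸ hiS)) ha
    obtain ⟨L, hL, hD⟩ := ihn (S.erase i) (by rw [Finset.card_erase_of_mem hiS]; omega)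
      (rs s t i) (rt s t i) (hg.refl i) (hP s t i hp) (by
        intro a ha
        unfold rs rt at *
        split_ifs at * with h
        · simp [h] at ha
        · rw [Finset.mem_erase] at *
          exact ⟨h, hin a ha.2⟩)
    refine ⟨i :: L, ⟨hi', hL⟩, fun v hv h1 hl => ?_⟩
    by_cases hvi : v = Pi.single i 1
    · exact Or.inl hvi
    · refine Or.inr ⟨hv i, hD _ (sig_nonneg hg.pos hi' v hv h1 hvi) ?_ ?_⟩
      · rw [eu_sig hi', h1]
      · rw [ell_sig hg hi']
        have : ∑ j ∈ S.erase i, ((sig s t i v j : ℤ) : ℝ) = ∑ j ∈ S.erase i, (v j : ℝ) :=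
          Finset.sum_congr rfl fun j hj => by rw [sig_ne _ _ _ _ (Finset.ne_of_mem_erase hj)]
        rw [this]
        have := Finset.add_sum_erase S (fun j => (v j : ℝ)) hiS
        linarith

lemma exists_seq {ρ : I → ℝ} (P : (A → I) → (A → I) → Prop)
    (hP : ∀ s t i, P s t → P (rs s t i) (rt s t i)) (M : ℝ)
    (hM : ∀ s t : A → I, Good ρ s t → P s t → ∀ v : I → ℤ, (∀ j, 0 ≤ v j) →
      eu s t v v = 1 → -M < ell ρ s t v) (m : ℕ) :
    ∀ s t : A → I, Good ρ s t → P s t → ∃ L, Adm L s t ∧ ∀ v : I → ℤ, (∀ j, 0 ≤ v j) →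
      eu s t v v = 1 → ell ρ s t v ≤ m - M → Dies L s t v := by
  induction m with
  | zero =>
    intro s t hg hp
    refine ⟨[], trivial, fun v hv h1 hl => ?_⟩
    have := hM s t hg hp v hv h1
    simp at hl
    linarith
  | succ m ih =>
    intro s t hg hp
    obtain ⟨L, hL, hD⟩ := cycle_step P hP _ ih _ Finset.univ rfl s t hg hp (by simp)
    refine ⟨L, hL, fun v hv h1 hl => hD v hv h1 ?_⟩
    have : (1 : ℝ) ≤ ∑ i, (v i : ℝ) := by
      have h0 : v ≠ 0 := by rintro rfl; simp [eu] at h1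
      obtain ⟨j, hj⟩ := Function.ne_iff.mp h0
      have hj' : 1 ≤ v j := by have := hv j; simp at hj; omega
      calc (1 : ℝ) ≤ (v j : ℝ) := by exact_mod_cast hj'
        _ ≤ _ := Finset.single_le_sum (f := fun i => (v i : ℝ))
          (fun i _ => by exact_mod_cast hv i) (Finset.mem_univ j)
    push_cast at hl
    linarith

lemma eu_add_left (s t : A → I) (u v w : I → R) : eu s t (u + v) w = eu s t u w + eu s t v w := by
  simp only [eu, Pi.add_apply, add_mul, Finset.sum_add_distrib]; ring

lemma eu_add_right (s t : A → I) (u v w : I → R) : eu s t w (u + v) = eu s t w u + eu s t w v := by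
  simp only [eu, Pi.add_apply, mul_add, Finset.sum_add_distrib]; ring

lemma eu_smul_left (s t : A → I) (c : R) (v w : I → R) : eu s t (c • v) w = c * eu s t v w := by
  simp only [eu, Pi.smul_apply, smul_eq_mul, mul_assoc, ← Finset.mul_sum]; ring

lemma eu_smul_right (s t : A → I) (c : R) (v w : I → R) : eu s t w (c • v) = c * eu s t w v := by
  simp only [eu, Pi.smul_apply, smul_eq_mul, mul_left_comm _ c, ← Finset.mul_sum]; ring

/-- The symmetrized form represents each functional. -/
lemma exists_rep {s t : A → I} (hpos : ∀ v : I → ℝ, v ≠ 0 → 0 < eu s t v v)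
    (f : (I → ℝ) →ₗ[ℝ] ℝ) : ∃ ρ : I → ℝ, ∀ u, eu s t ρ u + eu s t u ρ = f u := by
  let B : (I → ℝ) →ₗ[ℝ] (I → ℝ) →ₗ[ℝ] ℝ := LinearMap.mk₂ ℝ (fun x y => eu s t x y + eu s t y x)
    (by intro a b c; simp only [eu_add_left, eu_add_right]; ring)
    (by intro a b c; simp only [eu_smul_left, eu_smul_right, smul_eq_mul]; ring)
    (by intro a b c; simp only [eu_add_left, eu_add_right]; ring)
    (by intro a b c; simp only [eu_smul_left, eu_smul_right, smul_eq_mul]; ring)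
  have hinj : Function.Injective B := by
    rw [injective_iff_map_eq_zero]
    intro x hx
    by_contra h
    have h1 := hpos x h
    have h2 : eu s t x x + eu s t x x = 0 := by
      have := LinearMap.congr_fun hx x
      simpa [B] using this
    linarith
  have hsurj : Function.Surjective B :=
    (LinearMap.injective_iff_surjective_of_finrank_eq_finrank
      (by rw [Module.finrank_linearMap]; simp)).mp hinj
  obtain ⟨ρ, hρ⟩ := hsurj f
  exact ⟨ρ, fun u => by rw [← hρ]; rfl⟩

lemma exists_bound {s t : A → I} (hpos : ∀ v : I → ℝ, v ≠ 0 → 0 < eu s t v v) :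
    ∃ B : ℝ, 0 ≤ B ∧ ∀ v : I → ℤ, (∀ j, 0 ≤ v j) → eu s t v v = 1 → ∀ j, (v j : ℝ) ≤ B := by
  have h0 : ∀ v : I → ℝ, 0 ≤ eu s t v v := by
    intro v
    by_cases h : v = 0
    · subst h; simp [eu]
    · exact (hpos v h).le
  choose ω hω using fun j : I => exists_rep hpos (LinearMap.proj j)
  refine ⟨∑ j, (eu s t (ω j) (ω j) + 1), Finset.sum_nonneg fun j _ => by linarith [h0 (ω j)],
    fun v hv h1 j => ?_⟩
  have h2 : (v j : ℝ) ≤ eu s t (ω j) (ω j) + 1 := by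
    have h3 := h0 (ω j + (-1 : ℝ) • (fun i => (v i : ℝ)))
    have h4 := hω j (fun i => (v i : ℝ))
    have h5 : eu s t (fun i => (v i : ℝ)) (fun i => (v i : ℝ)) = 1 := by
      have : eu s t (fun i => (v i : ℝ)) (fun i => (v i : ℝ)) = ((eu s t v v : ℤ) : ℝ) := by
        unfold eu; push_cast; rfl
      rw [this, h1]; simp
    simp only [eu_add_left, eu_add_right, eu_smul_left, eu_smul_right, h5] at h3
    simp only [LinearMap.proj_apply] at h4
    linarith
  exact h2.trans (Finset.single_le_sum (f := fun j => eu s t (ω j) (ω j) + 1)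
    (fun j _ => by linarith [h0 (ω j)]) (Finset.mem_univ j))

/-- Every finite set of positive roots dies along a common sequence. -/
lemma exists_dies {s t : A → I} (hpos : ∀ v : I → ℝ, v ≠ 0 → 0 < eu s t v v)
    (hl : ∀ a, s a ≠ t a) (v w : I → ℤ) (hv : ∀ j, 0 ≤ v j) (hv1 : eu s t v v = 1)
    (hw : ∀ j, 0 ≤ w j) (hw1 : eu s t w w = 1) :
    ∃ L, Adm L s t ∧ Dies L s t v ∧ Dies L s t w := by
  obtain ⟨ρ, hρ⟩ := exists_rep hpos (∑ j, LinearMap.proj j)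
  obtain ⟨B, hB0, hB⟩ := exists_bound hpos
  have hg : Good ρ s t := ⟨hpos, fun i => by rw [hρ]; simp [LinearMap.sum_apply], hl⟩
  set N : ℝ := ∑ j, |ρ j| with hN
  have hN1 : ∀ j, |ρ j| ≤ N := fun j =>
    Finset.single_le_sum (f := fun j => |ρ j|) (fun _ _ => abs_nonneg _) (Finset.mem_univ j)
  have key := exists_seq (ρ := ρ)
    (fun (s' t' : A → I) => ∀ u : I → ℤ, eu s' t' u u = eu s t u u)
    (by
      intro s' t' i h u
      have := sy_refl s' t' i u u
      have := h u
      omega)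
    (B * N + Fintype.card A * (B * N) + 1)
    (by
      intro s' t' _ hp u hu hu1
      rw [hp] at hu1
      have hb := hB u hu hu1
      have hu' : ∀ j, (0 : ℝ) ≤ u j := fun j => by exact_mod_cast hu j
      simp only [ell, eu]
      have e1 : -(B * N) ≤ ∑ i, (u i : ℝ) * ρ i := by
        rw [hN, Finset.mul_sum, ← Finset.sum_neg_distrib]
        refine Finset.sum_le_sum fun j _ => ?_
        have h1 : (u j : ℝ) * |ρ j| ≤ B * |ρ j| := by gcongr; exact hb j
        have h2 : (u j : ℝ) * (-|ρ j|) ≤ u j * ρ j :=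
          mul_le_mul_of_nonneg_left (neg_abs_le _) (hu' j)
        linarith
      have e2 : ∑ a, (u (s' a) : ℝ) * ρ (t' a) ≤ Fintype.card A * (B * N) := by
        have : ∑ a : A, (u (s' a) : ℝ) * ρ (t' a) ≤ ∑ a : A, B * N := by
          refine Finset.sum_le_sum fun a _ => ?_
          have h2 : (u (s' a) : ℝ) * ρ (t' a) ≤ u (s' a) * |ρ (t' a)| :=
            mul_le_mul_of_nonneg_left (le_abs_self _) (hu' _)
          exact h2.trans (mul_le_mul (hb _) (hN1 _) (abs_nonneg _) hB0)
        simpa using this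
      linarith)
  obtain ⟨m, hm⟩ := exists_nat_ge (max (ell ρ s t v) (ell ρ s t w) +
    (B * N + Fintype.card A * (B * N) + 1))
  obtain ⟨L, hL, hD⟩ := key m s t hg (fun _ => rfl)
  have h1 := le_max_left (ell ρ s t v) (ell ρ s t w)
  have h2 := le_max_right (ell ρ s t v) (ell ρ s t w)
  exact ⟨L, hL, hD v hv hv1 (by linarith), hD w hw hw1 (by linarith)⟩

end Num

/-! ### Representations -/

section Reps

set_option linter.unusedSectionVars false

variable {I A : Type} [Fintype I] [Fintype A] [DecidableEq I]

/-- Data of a quiver representation on a total space `E`: the vertex projections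
and the arrow operators. -/
structure RD (I A E : Type) [AddCommGroup E] [Module ℚ E] where
  /-- vertex projections -/
  π : I → E →ₗ[ℚ] E
  /-- arrow operators -/
  F : A → E →ₗ[ℚ] E

variable {E E' : Type} [AddCommGroup E] [Module ℚ E] [AddCommGroup E'] [Module ℚ E']

/-- The laws of a representation. -/
structure IsRp (s t : A → I) (X : RD I A E) : Prop where
  idem : ∀ j x, X.π j (X.π j x) = X.π j x
  orth : ∀ j l x, j ≠ l → X.π j (X.π l x) = 0
  sum : ∀ x, ∑ j, X.π j x = x
  tgt : ∀ a x, X.π (t a) (X.F a x) = X.F a x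
  src : ∀ a x, X.F a (X.π (s a) x) = X.F a x

lemma IsRp.tgt_ne {s t : A → I} {X : RD I A E} (h : IsRp s t X) {a : A} {j : I} (hj : t a ≠ j)
    (x : E) : X.π j (X.F a x) = 0 := by
  rw [← h.tgt, h.orth _ _ _ hj.symm]

lemma IsRp.src_ne {s t : A → I} {X : RD I A E} (h : IsRp s t X) {a : A} {j : I} (hj : s a ≠ j)
    (x : E) : X.F a (X.π j x) = 0 := by
  rw [← h.src, h.orth _ _ _ hj, map_zero]

/-- Dimension vector. -/
def RD.dim (X : RD I A E) (j : I) : ℕ := Module.finrank ℚ (LinearMap.range (X.π j))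

/-- Homomorphisms. -/
def Hm (X : RD I A E) (Y : RD I A E') : Submodule ℚ (E →ₗ[ℚ] E') where
  carrier := {φ | (∀ j x, φ (X.π j x) = Y.π j (φ x)) ∧ ∀ a x, φ (X.F a x) = Y.F a (φ x)}
  add_mem' := by
    rintro φ ψ ⟨h1, h2⟩ ⟨h3, h4⟩
    exact ⟨fun j x => by simp [h1, h3], fun a x => by simp [h2, h4]⟩
  zero_mem' := ⟨fun j x => by simp, fun a x => by simp⟩
  smul_mem' := by
    rintro c φ ⟨h1, h2⟩
    exact ⟨fun j x => by simp [h1], fun a x => by simp [h2]⟩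

lemma mem_Hm {X : RD I A E} {Y : RD I A E'} {φ : E →ₗ[ℚ] E'} : φ ∈ Hm X Y ↔
    (∀ j x, φ (X.π j x) = Y.π j (φ x)) ∧ ∀ a x, φ (X.F a x) = Y.F a (φ x) := Iff.rfl

/-- The simple representation at `i`. -/
def simpleRp (I A : Type) [DecidableEq I] (i : I) : RD I A ℚ where
  π j := if j = i then LinearMap.id else 0
  F _ := 0

lemma simple_isRp (s t : A → I) (i : I) : IsRp s t (simpleRp I A i) where
  idem j x := by
    change (if j = i then LinearMap.id else 0 : ℚ →ₗ[ℚ] ℚ) ((if j = i then LinearMap.id else 0 : ℚ →ₗ[ℚ] ℚ) x) = (if j = i then LinearMap.id else 0 : ℚ →ₗ[ℚ] ℚ) x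
    split_ifs <;> simp
  orth j l x h := by
    change (if j = i then LinearMap.id else 0 : ℚ →ₗ[ℚ] ℚ) ((if l = i then LinearMap.id else 0 : ℚ →ₗ[ℚ] ℚ) x) = 0
    split_ifs <;> simp
    subst_vars; exact absurd rfl h
  sum x := by
    change ∑ j, (if j = i then LinearMap.id else 0 : ℚ →ₗ[ℚ] ℚ) x = x
    rw [← LinearMap.sum_apply]; simp
  tgt a x := by simp [simpleRp]
  src a x := by simp [simpleRp]

lemma simple_dim (i j : I) : ((simpleRp I A i).dim j : ℤ) = (Pi.single i 1 : I → ℤ) j := by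
  change ((Module.finrank ℚ (LinearMap.range (if j = i then LinearMap.id else 0 : ℚ →ₗ[ℚ] ℚ)) : ℕ) : ℤ) = _
  by_cases h : j = i
  · subst h; rw [if_pos rfl, LinearMap.range_id]; simp
  · simp [h]

/-- The space of a reflected representation. -/
def Ksub (s t : A → I) (i : I) (X : RD I A E) : Submodule ℚ (E × (A → E)) where
  carrier := {p | X.π i p.1 = 0 ∧ (∀ a, s a = i → X.π (t a) (p.2 a) = p.2 a) ∧
    (∀ a, s a ≠ i → p.2 a = 0) ∧ ∑ a, X.F a (p.2 a) = 0}
  add_mem' := by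
    rintro p q ⟨h1, h2, h3, h4⟩ ⟨k1, k2, k3, k4⟩
    refine ⟨by simp [h1, k1], fun a ha => by simp [h2 a ha, k2 a ha],
      fun a ha => by simp [h3 a ha, k3 a ha], ?_⟩
    simp [Finset.sum_add_distrib, h4, k4]
  zero_mem' := by simp
  smul_mem' := by
    rintro c p ⟨h1, h2, h3, h4⟩
    refine ⟨by simp [h1], fun a ha => by simp [h2 a ha],
      fun a ha => by simp [h3 a ha], ?_⟩
    simp [← Finset.smul_sum, h4]

lemma mem_Ksub {s t : A → I} {i : I} {X : RD I A E} {p : E × (A → E)} :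
    p ∈ Ksub s t i X ↔ X.π i p.1 = 0 ∧ (∀ a, s a = i → X.π (t a) (p.2 a) = p.2 a) ∧
    (∀ a, s a ≠ i → p.2 a = 0) ∧ ∑ a, X.F a (p.2 a) = 0 := Iff.rfl

/-- ambient projections -/
def rfPi (i : I) (X : RD I A E) (j : I) : E × (A → E) →ₗ[ℚ] E × (A → E) :=
  if j = i then LinearMap.inr ℚ _ _ ∘ₗ LinearMap.snd ℚ _ _
  else LinearMap.inl ℚ _ _ ∘ₗ X.π j ∘ₗ LinearMap.fst ℚ _ _

/-- ambient arrow operators -/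
def rfF (s : A → I) (i : I) (X : RD I A E) (a : A) : E × (A → E) →ₗ[ℚ] E × (A → E) :=
  if s a = i then LinearMap.inl ℚ _ _ ∘ₗ LinearMap.proj a ∘ₗ LinearMap.snd ℚ _ _
  else LinearMap.inl ℚ _ _ ∘ₗ X.F a ∘ₗ LinearMap.fst ℚ _ _

lemma rfPi_apply (i : I) (X : RD I A E) (j : I) (p : E × (A → E)) :
    rfPi i X j p = if j = i then (0, p.2) else (X.π j p.1, 0) := by
  unfold rfPi; split_ifs <;> simp

lemma rfF_apply (s : A → I) (i : I) (X : RD I A E) (a : A) (p : E × (A → E)) :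
    rfF s i X a p = if s a = i then (p.2 a, 0) else (X.F a p.1, 0) := by
  unfold rfF; split_ifs <;> simp

section Refl

variable {s t : A → I} {i : I} {X : RD I A E}

lemma rs_of_eq {a : A} (h : s a = i) : rs s t i a = t a := by simp [rs, h]
lemma rt_of_eq {a : A} (h : s a = i) : rt s t i a = i := by simp [rt, h]
lemma rs_of_ne {a : A} (h : s a ≠ i) : rs s t i a = s a := by simp [rs, h]
lemma rt_of_ne {a : A} (h : s a ≠ i) : rt s t i a = t a := by simp [rt, h]

lemma rfPi_mem (hX : IsRp (rs s t i) (rt s t i) X) (j : I) :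
    ∀ p ∈ Ksub s t i X, rfPi i X j p ∈ Ksub s t i X := by
  rintro p ⟨h1, h2, h3, h4⟩
  rw [rfPi_apply]
  split_ifs with h
  · exact ⟨by simp, h2, h3, h4⟩
  · exact ⟨hX.orth _ _ _ (Ne.symm h), by simp, by simp, by simp⟩

lemma rfF_mem (hi : ∀ a, t a ≠ i) (hX : IsRp (rs s t i) (rt s t i) X) (a : A) :
    ∀ p ∈ Ksub s t i X, rfF s i X a p ∈ Ksub s t i X := by
  rintro p ⟨h1, h2, h3, h4⟩
  rw [rfF_apply]
  split_ifs with h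
  · refine ⟨?_, by simp, by simp, by simp⟩
    simp only
    rw [← h2 a h, hX.orth _ _ _ (hi a).symm]
  · refine ⟨?_, by simp, by simp, by simp⟩
    apply hX.tgt_ne
    rw [rt_of_ne h]; exact hi a

/-- The reflected representation. -/
def refl (hi : ∀ a, t a ≠ i) (hX : IsRp (rs s t i) (rt s t i) X) : RD I A (Ksub s t i X) where
  π j := (rfPi i X j).restrict (rfPi_mem hX j)
  F a := (rfF s i X a).restrict (rfF_mem hi hX a)

lemma refl_pi (hi : ∀ a, t a ≠ i) (hX : IsRp (rs s t i) (rt s t i) X) (j : I)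
    (k : Ksub s t i X) : (((refl hi hX).π j k : Ksub s t i X) : E × (A → E)) =
      if j = i then (0, k.1.2) else (X.π j k.1.1, 0) := by
  rw [← rfPi_apply]; rfl

lemma refl_F (hi : ∀ a, t a ≠ i) (hX : IsRp (rs s t i) (rt s t i) X) (a : A)
    (k : Ksub s t i X) : (((refl hi hX).F a k : Ksub s t i X) : E × (A → E)) =
      if s a = i then (k.1.2 a, 0) else (X.F a k.1.1, 0) := by
  rw [← rfF_apply]; rfl

lemma refl_isRp (hi : ∀ a, t a ≠ i) (hX : IsRp (rs s t i) (rt s t i) X) :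
    IsRp s t (refl hi hX) where
  idem j x := by
    apply Subtype.ext
    rw [refl_pi, refl_pi]
    split_ifs <;> simp [hX.idem]
  orth j l x h := by
    apply Subtype.ext
    rw [refl_pi, refl_pi]
    split_ifs with h1 h2
    · exact absurd (h1.trans h2.symm) h
    · rfl
    · simp
    · simp only [hX.orth _ _ _ h]; rfl
  sum x := by
    apply Subtype.ext
    change (Ksub s t i X).subtype (∑ j, (refl hi hX).π j x) = _
    rw [map_sum]
    change ∑ j, (((refl hi hX).π j x : Ksub s t i X) : E × (A → E)) = _
    simp only [refl_pi]
    obtain ⟨⟨x, y⟩, h1, h2, h3, h4⟩ := x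
    have hx := hX.sum x
    have e : ∀ j, (if j = i then ((0, y) : E × (A → E)) else (X.π j x, 0)) =
        (X.π j x, if j = i then y else 0) := by
      intro j
      split_ifs with h
      · subst h; simp only at h1; rw [h1]
      · rfl
    simp only [e]
    rw [Prod.ext_iff, Prod.fst_sum, Prod.snd_sum]
    simp [hx]
  tgt a x := by
    apply Subtype.ext
    rw [refl_pi, refl_F, if_neg (hi a)]
    obtain ⟨p, h1, h2, h3, h4⟩ := x
    split_ifs with h
    · simp [h2 a h]
    · have := hX.tgt a p.1
      rw [rt_of_ne h] at this
      simp [this]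
  src a x := by
    apply Subtype.ext
    rw [refl_F, refl_F, refl_pi]
    split_ifs with h
    · rfl
    · have := hX.src a x.1.1
      rw [rs_of_ne h] at this
      simp [this]

/-- The map from the neighbours to the sink. -/
def Gm (s : A → I) (i : I) (X : RD I A E) : (A → E) →ₗ[ℚ] E :=
  ∑ a, if s a = i then X.F a ∘ₗ LinearMap.proj a else 0

lemma Gm_apply (y : A → E) : Gm s i X y = ∑ a, if s a = i then X.F a (y a) else 0 := by
  unfold Gm
  rw [LinearMap.sum_apply]
  refine Finset.sum_congr rfl fun a _ => ?_
  split_ifs <;> simp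

lemma pi_Gm (hX : IsRp (rs s t i) (rt s t i) X) (y : A → E) :
    X.π i (Gm s i X y) = Gm s i X y := by
  rw [Gm_apply, map_sum]
  refine Finset.sum_congr rfl fun a _ => ?_
  split_ifs with h
  · have := hX.tgt a (y a)
    rwa [rt_of_eq h] at this
  · simp

lemma pi_Gm_ne (hX : IsRp (rs s t i) (rt s t i) X) {j : I} (hj : j ≠ i) (y : A → E) :
    X.π j (Gm s i X y) = 0 := by
  rw [← pi_Gm hX, hX.orth _ _ _ hj]

lemma F_pi_i (hi : ∀ a, t a ≠ i) (hX : IsRp (rs s t i) (rt s t i) X) (a : A) (x : E) :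
    X.F a (X.π i x) = 0 := by
  apply hX.src_ne
  by_cases h : s a = i
  · rw [rs_of_eq h]; exact hi a
  · rw [rs_of_ne h]; exact h

lemma pi_F_eq (hX : IsRp (rs s t i) (rt s t i) X) {a : A} (h : s a = i) (x : E) :
    X.π i (X.F a x) = X.F a x := by
  have := hX.tgt a x
  rwa [rt_of_eq h] at this

lemma F_pi_eq (hX : IsRp (rs s t i) (rt s t i) X) {a : A} (h : s a = i) (x : E) :
    X.F a (X.π (t a) x) = X.F a x := by
  have := hX.src a x
  rwa [rs_of_eq h] at this

lemma pi_F_ne (hi : ∀ a, t a ≠ i) (hX : IsRp (rs s t i) (rt s t i) X) {a : A} (h : s a ≠ i)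
    (x : E) : X.π i (X.F a x) = 0 := by
  apply hX.tgt_ne; rw [rt_of_ne h]; exact hi a

/-- A linear section of the map to the sink. -/
lemma exists_section (hs : LinearMap.range (X.π i) ≤ LinearMap.range (Gm s i X)) :
    ∃ S : E →ₗ[ℚ] (A → E), ∀ x, Gm s i X (S x) = X.π i x := by
  obtain ⟨h, hh⟩ := Module.projective_lifting_property (Gm s i X).rangeRestrict
    ((X.π i).codRestrict (LinearMap.range (Gm s i X)) (fun x => hs ⟨x, rfl⟩))
    (LinearMap.surjective_rangeRestrict _)
  refine ⟨h, fun x => ?_⟩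
  have := congrArg Subtype.val (LinearMap.congr_fun hh x)
  simpa using this

end Refl

section Hom

variable {s t : A → I} {i : I} {X : RD I A E} {Y : RD I A E'}

lemma big_mem {φ : E →ₗ[ℚ] E'} (hφ : φ ∈ Hm X Y) :
    ∀ p ∈ Ksub s t i X, (φ.prodMap (φ.compLeft A)) p ∈ Ksub s t i Y := by
  rintro p ⟨h1, h2, h3, h4⟩
  obtain ⟨k1, k2⟩ := mem_Hm.mp hφ
  refine ⟨?_, ?_, ?_, ?_⟩
  · simp [← k1, h1]
  · intro a ha; simp [← k1, h2 a ha]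
  · intro a ha; simp [h3 a ha]
  · simp [← k2, ← map_sum, h4]

/-- Functoriality of the reflection. -/
def homMap (hi : ∀ a, t a ≠ i) (hX : IsRp (rs s t i) (rt s t i) X)
    (hY : IsRp (rs s t i) (rt s t i) Y) : Hm X Y →ₗ[ℚ] Hm (refl hi hX) (refl hi hY) where
  toFun φ := ⟨(φ.1.prodMap (φ.1.compLeft A)).restrict (big_mem φ.2), by
    obtain ⟨φ, hφ⟩ := φ
    obtain ⟨k1, k2⟩ := mem_Hm.mp hφ
    refine mem_Hm.mpr ⟨fun j x => ?_, fun a x => ?_⟩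
    · apply Subtype.ext
      rw [refl_pi]
      change (φ.prodMap (φ.compLeft A)) (((refl hi hX).π j x : Ksub s t i X) : E × (A → E)) = _
      rw [refl_pi]
      split_ifs with h
      · ext <;> simp
      · ext <;> simp [k1]
    · apply Subtype.ext
      rw [refl_F]
      change (φ.prodMap (φ.compLeft A)) (((refl hi hX).F a x : Ksub s t i X) : E × (A → E)) = _
      rw [refl_F]
      split_ifs with h
      · ext <;> simp
      · ext <;> simp [k2]⟩
  map_add' φ ψ := by
    apply Subtype.ext; apply LinearMap.ext; intro x; apply Subtype.ext; rfl
  map_smul' c φ := by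
    apply Subtype.ext; apply LinearMap.ext; intro x; apply Subtype.ext; rfl

lemma homMap_apply (hi : ∀ a, t a ≠ i) (hX : IsRp (rs s t i) (rt s t i) X)
    (hY : IsRp (rs s t i) (rt s t i) Y) (φ : Hm X Y) (k : Ksub s t i X) :
    (((homMap hi hX hY φ).1 k : Ksub s t i Y) : E' × (A → E')) =
      (φ.1 k.1.1, fun a => φ.1 (k.1.2 a)) := rfl

lemma homMap_inj (hi : ∀ a, t a ≠ i) (hX : IsRp (rs s t i) (rt s t i) X)
    (hY : IsRp (rs s t i) (rt s t i) Y)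
    (hs : LinearMap.range (X.π i) ≤ LinearMap.range (Gm s i X)) :
    Function.Injective (homMap hi hX hY) := by
  rw [injective_iff_map_eq_zero]
  rintro φ h0
  obtain ⟨k1, k2⟩ := mem_Hm.mp φ.2
  have e1 : ∀ x, X.π i x = 0 → φ.1 x = 0 := by
    intro x hx
    have := homMap_apply hi hX hY φ ⟨(x, 0), hx, by simp, by simp, by simp⟩
    rw [h0] at this
    exact (congrArg Prod.fst this).symm
  have e2 : ∀ a x, s a = i → φ.1 (X.F a x) = 0 := by
    intro a x ha
    rw [← F_pi_eq hX ha, k2, e1, map_zero]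
    exact hX.orth _ _ _ (hi a).symm
  obtain ⟨S, hS⟩ := exists_section hs
  apply Subtype.ext
  apply LinearMap.ext
  intro x
  have e3 : φ.1 (X.π i x) = 0 := by
    rw [← hS, Gm_apply, map_sum]
    refine Finset.sum_eq_zero fun a _ => ?_
    split_ifs with h
    · exact e2 a _ h
    · simp
  have e4 := e1 (x - X.π i x) (by rw [map_sub, hX.idem, sub_self])
  rw [map_sub, e3, sub_zero] at e4
  simpa using e4

lemma homMap_surj (hi : ∀ a, t a ≠ i) (hX : IsRp (rs s t i) (rt s t i) X)
    (hY : IsRp (rs s t i) (rt s t i) Y)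
    (hs : LinearMap.range (X.π i) ≤ LinearMap.range (Gm s i X)) :
    Function.Surjective (homMap hi hX hY) := by
  rintro ⟨ψ', hψ⟩
  obtain ⟨q1, q2⟩ := mem_Hm.mp hψ
  -- work with the underlying subspaces
  let ψ : Ksub s t i X →ₗ[ℚ] Ksub s t i Y := ψ'
  have p1 : ∀ j (k : Ksub s t i X), (ψ ((refl hi hX).π j k)).1 =
      if j = i then (0, (ψ k).1.2) else (Y.π j (ψ k).1.1, 0) := by
    intro j k
    rw [← refl_pi hi hY]
    exact congrArg Subtype.val (q1 j k)
  have p2 : ∀ a (k : Ksub s t i X), (ψ ((refl hi hX).F a k)).1 =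
      if s a = i then ((ψ k).1.2 a, 0) else (Y.F a (ψ k).1.1, 0) := by
    intro a k
    rw [← refl_F hi hY]
    exact congrArg Subtype.val (q2 a k)
  clear q1 q2
  let ι : E →ₗ[ℚ] Ksub s t i X :=
    (LinearMap.inl ℚ E (A → E) ∘ₗ (LinearMap.id - X.π i)).codRestrict (Ksub s t i X) (by
      intro x
      refine ⟨by simp [hX.idem], by simp, by simp, by simp⟩)
  have hι : ∀ x, (ι x).1 = (x - X.π i x, 0) := by intro x; rfl
  have hι0 : ∀ x (hx : X.π i x = 0) h, ι x = ⟨(x, 0), h⟩ := by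
    intro x hx h; apply Subtype.ext; rw [hι, hx, sub_zero]
  let φ0 : E →ₗ[ℚ] E' := LinearMap.fst ℚ _ _ ∘ₗ (Ksub s t i Y).subtype ∘ₗ ψ ∘ₗ ι
  have hφ0 : ∀ x, φ0 x = (ψ (ι x)).1.1 := fun x => rfl
  have f1 : ∀ k : Ksub s t i X, (ψ k).1.1 = φ0 k.1.1 := by
    intro k
    have hk : k = ι k.1.1 + (refl hi hX).π i k := by
      apply Subtype.ext
      change _ = (ι k.1.1).1 + (((refl hi hX).π i k : Ksub s t i X) : E × (A → E))
      rw [refl_pi, hι, k.2.1]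
      ext <;> simp
    have h2 := p1 i k
    rw [if_pos rfl] at h2
    have h3 : ψ k = ψ (ι k.1.1) + ψ ((refl hi hX).π i k) := by
      rw [← map_add]; exact congrArg ψ hk
    rw [h3, hφ0]
    change (ψ (ι k.1.1)).1.1 + (ψ ((refl hi hX).π i k)).1.1 = _
    rw [h2, add_zero]
  have f2 : ∀ (k : Ksub s t i X) a, s a = i → (ψ k).1.2 a = φ0 (k.1.2 a) := by
    intro k a ha
    have h := p2 a k
    rw [if_pos ha] at h
    have h1 := congrArg Prod.fst h
    simp only at h1
    rw [← h1, f1]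
    congr 1
    have := refl_F hi hX a k
    rw [if_pos ha] at this
    exact congrArg Prod.fst this
  have f3 : ∀ j, j ≠ i → ∀ x, φ0 (X.π j x) = Y.π j (φ0 x) := by
    intro j hj x
    have h := p1 j (ι x)
    rw [if_neg hj] at h
    have h1 := congrArg Prod.fst h
    simp only at h1
    rw [hφ0 x, ← h1, f1]
    congr 1
    have := refl_pi hi hX j (ι x)
    rw [if_neg hj, hι] at this
    have := congrArg Prod.fst this
    simp only [map_sub, hX.orth _ _ _ hj, sub_zero] at this
    exact this.symm
  have f3i : ∀ x, φ0 (X.π i x) = 0 := by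
    intro x
    have : ι (X.π i x) = 0 := by
      apply Subtype.ext; rw [hι, hX.idem, sub_self]; rfl
    rw [hφ0, this, map_zero]; rfl
  have f3i' : ∀ x, Y.π i (φ0 x) = 0 := fun x => (ψ (ι x)).2.1
  have f3F : ∀ a, s a ≠ i → ∀ x, φ0 (X.F a x) = Y.F a (φ0 x) := by
    intro a ha x
    have h := p2 a (ι x)
    rw [if_neg ha] at h
    have h1 := congrArg Prod.fst h
    simp only at h1
    rw [hφ0 x, ← h1, f1]
    congr 1
    have := refl_F hi hX a (ι x)
    rw [if_neg ha, hι] at this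
    have := congrArg Prod.fst this
    simp only [map_sub, F_pi_i hi hX, sub_zero] at this
    exact this.symm
  have f4 : ∀ y, Gm s i X y = 0 → Gm s i Y (fun a => φ0 (y a)) = 0 := by
    intro y hy
    have hk : ((0, fun a => if s a = i then X.π (t a) (y a) else 0) : E × (A → E)) ∈
        Ksub s t i X := by
      refine ⟨by simp, fun a ha => by simp [ha, hX.idem], fun a ha => by simp [ha], ?_⟩
      rw [Gm_apply] at hy
      refine (Finset.sum_congr rfl fun a _ => ?_).trans hy
      simp only
      split_ifs with h
      · rw [F_pi_eq hX h]
      · simp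
    have hz := (ψ ⟨_, hk⟩).2.2.2.2
    rw [Gm_apply]
    refine (Finset.sum_congr rfl fun a _ => ?_).trans hz
    split_ifs with h
    · rw [f2 _ a h]
      simp only [h, if_true]
      rw [f3 _ (hi a), F_pi_eq hY h]
    · rw [(ψ ⟨_, hk⟩).2.2.2.1 a h, map_zero]
  obtain ⟨S, hS⟩ := exists_section hs
  let φ : E →ₗ[ℚ] E' := φ0 + Gm s i Y ∘ₗ (φ0.compLeft A) ∘ₗ S
  have hφ : ∀ x, φ x = φ0 x + Gm s i Y (fun a => φ0 (S x a)) := fun x => rfl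
  have f5 : ∀ x, X.π i x = 0 → φ x = φ0 x := by
    intro x hx
    rw [hφ, f4 (S x) (by rw [hS, hx]), add_zero]
  have f6 : ∀ y y', Gm s i X y = Gm s i X y' →
      Gm s i Y (fun a => φ0 (y a)) = Gm s i Y (fun a => φ0 (y' a)) := by
    intro y y' h
    have := f4 (y - y') (by rw [map_sub, h, sub_self])
    rw [← sub_eq_zero, ← map_sub, ← this]
    congr 1
    funext a
    simp
  have hmem : φ ∈ Hm X Y := by
    refine mem_Hm.mpr ⟨fun j x => ?_, fun a x => ?_⟩
    · by_cases hj : j = i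
      · subst hj
        rw [hφ, hφ, f3i, map_add, f3i', pi_Gm hY, f6 (S (X.π j x)) (S x)]
        rw [hS, hS, hX.idem]
      · rw [f5 _ (hX.orth _ _ _ (Ne.symm hj)), hφ, map_add, pi_Gm_ne hY hj, add_zero, f3 j hj]
    · by_cases ha : s a = i
      · have hz : Y.F a (Gm s i Y (fun a => φ0 (S x a))) = 0 := by
          rw [← pi_Gm hY, F_pi_i hi hY]
        rw [hφ, hφ, map_add, hz, add_zero]
        classical
        have h1 : φ0 (X.F a x) = 0 := by rw [← pi_F_eq hX ha, f3i]
        have hG : ∀ {G : Type} [AddCommGroup G] [Module ℚ G] (Z : RD I A G) (z : G), Gm s i Z (Pi.single a z) = Z.F a z := by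
          intro G _ _ Z z
          rw [Gm_apply, Finset.sum_eq_single a]
          · simp [ha]
          · intro b _ hb; simp [hb]
          · simp
        rw [h1, zero_add, f6 _ (Pi.single a x) (by rw [hS, hG, pi_F_eq hX ha]), ← hG Y]
        congr 1
        funext b
        by_cases hb : b = a
        · subst hb; simp
        · simp [hb]
      · have hz : Y.F a (Gm s i Y (fun a => φ0 (S x a))) = 0 := by
          rw [← pi_Gm hY, F_pi_i hi hY]
        rw [f5 _ (pi_F_ne hi hX ha _), hφ, map_add, hz, add_zero, f3F a ha]
  refine ⟨⟨φ, hmem⟩, ?_⟩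
  apply Subtype.ext
  apply LinearMap.ext
  intro k
  apply Subtype.ext
  rw [homMap_apply]
  change _ = (ψ k).1
  refine Prod.ext ?_ ?_
  · simp only
    rw [f1, f5 _ k.2.1]
  · funext a
    simp only
    by_cases ha : s a = i
    · rw [f2 k a ha, f5]
      rw [← k.2.2.1 a ha]
      exact hX.orth _ _ _ (hi a).symm
    · rw [k.2.2.2.1 a ha, (ψ k).2.2.2.1 a ha, map_zero]

lemma finrank_hom_refl (hi : ∀ a, t a ≠ i) (hX : IsRp (rs s t i) (rt s t i) X)
    (hY : IsRp (rs s t i) (rt s t i) Y)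
    (hs : LinearMap.range (X.π i) ≤ LinearMap.range (Gm s i X)) :
    Module.finrank ℚ (Hm (refl hi hX) (refl hi hY)) = Module.finrank ℚ (Hm X Y) :=
  (LinearEquiv.ofBijective _ ⟨homMap_inj hi hX hY hs, homMap_surj hi hX hY hs⟩).finrank_eq.symm

end Hom

end Reps

section Dims

set_option linter.unusedSectionVars false

variable {I A : Type} [Fintype I] [Fintype A] [DecidableEq I]
variable {E E' : Type} [AddCommGroup E] [Module ℚ E] [AddCommGroup E'] [Module ℚ E']
variable {s t : A → I} {i : I} {X : RD I A E} {Y : RD I A E'}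

lemma finrank_map_inj {M N : Type} [AddCommGroup M] [Module ℚ M] [AddCommGroup N] [Module ℚ N]
    (f : M →ₗ[ℚ] N) (hf : Function.Injective f) (p : Submodule ℚ M) :
    Module.finrank ℚ (p.map f) = Module.finrank ℚ p :=
  (Submodule.equivMapOfInjective f hf p).finrank_eq.symm

lemma refl_dim_ne (hi : ∀ a, t a ≠ i) (hX : IsRp (rs s t i) (rt s t i) X) {j : I} (hj : j ≠ i) :
    (refl hi hX).dim j = X.dim j := by
  unfold RD.dim
  rw [← finrank_map_inj (Ksub s t i X).subtype (Subtype.val_injective),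
    ← finrank_map_inj (LinearMap.inl ℚ E (A → E)) LinearMap.inl_injective]
  refine congrArg (fun p : Submodule ℚ (E × (A → E)) => Module.finrank ℚ p) ?_
  ext p
  constructor
  · rintro ⟨_, ⟨k, rfl⟩, rfl⟩
    refine ⟨X.π j k.1.1, ⟨_, rfl⟩, ?_⟩
    rw [Submodule.subtype_apply, refl_pi, if_neg hj]
    rfl
  · rintro ⟨_, ⟨x, rfl⟩, rfl⟩
    have hk : ((X.π j x, 0) : E × (A → E)) ∈ Ksub s t i X :=
      ⟨hX.orth _ _ _ (Ne.symm hj), by simp, by simp, by simp⟩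
    refine ⟨_, ⟨⟨_, hk⟩, rfl⟩, ?_⟩
    rw [Submodule.subtype_apply, refl_pi, if_neg hj]
    simp only [hX.idem]
    rfl

/-- The neighbouring spaces. -/
def Usub (s t : A → I) (i : I) (X : RD I A E) (a : A) : Submodule ℚ E :=
  if s a = i then LinearMap.range (X.π (t a)) else ⊥

lemma mem_Usub_eq {a : A} (h : s a = i) (x : E) :
    x ∈ Usub s t i X a ↔ ∃ y, X.π (t a) y = x := by
  unfold Usub; rw [if_pos h]; exact Iff.rfl

lemma mem_Usub_ne {a : A} (h : s a ≠ i) (x : E) : x ∈ Usub s t i X a ↔ x = 0 := by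
  unfold Usub; rw [if_neg h]; exact Submodule.mem_bot ℚ

/-- The map from the neighbouring spaces to the sink. -/
def Hmap (s t : A → I) (i : I) (X : RD I A E) : (∀ a, Usub s t i X a) →ₗ[ℚ] E :=
  ∑ a, X.F a ∘ₗ (Usub s t i X a).subtype ∘ₗ LinearMap.proj a

lemma Hmap_apply (y : ∀ a, Usub s t i X a) : Hmap s t i X y = ∑ a, X.F a (y a).1 := by
  unfold Hmap
  rw [LinearMap.sum_apply]; rfl

/-- Inclusion of the neighbouring spaces. -/
def Pmap (s t : A → I) (i : I) (X : RD I A E) : (∀ a, Usub s t i X a) →ₗ[ℚ] E × (A → E) where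
  toFun y := (0, fun a => (y a).1)
  map_add' x y := by
    refine Prod.ext (by simp) rfl
  map_smul' c y := by
    refine Prod.ext (by simp) rfl

lemma Pmap_inj : Function.Injective (Pmap s t i X) := by
  intro x y h
  funext a
  exact Subtype.ext (congrFun (congrArg Prod.snd h) a)

lemma range_Hmap (hX : IsRp (rs s t i) (rt s t i) X)
    (hs : LinearMap.range (X.π i) ≤ LinearMap.range (Gm s i X)) :
    LinearMap.range (Hmap s t i X) = LinearMap.range (X.π i) := by
  apply le_antisymm
  · rintro _ ⟨y, rfl⟩
    refine ⟨Hmap s t i X y, ?_⟩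
    rw [Hmap_apply, map_sum]
    refine Finset.sum_congr rfl fun a _ => ?_
    by_cases h : s a = i
    · exact pi_F_eq hX h _
    · rw [(mem_Usub_ne h _).mp (y a).2]; simp
  · rintro x hx
    obtain ⟨y, rfl⟩ := hs hx
    refine ⟨fun a => if h : s a = i then ⟨X.π (t a) (y a), (mem_Usub_eq h _).mpr ⟨_, rfl⟩⟩ else 0,
      ?_⟩
    rw [Hmap_apply, Gm_apply]
    refine Finset.sum_congr rfl fun a _ => ?_
    by_cases h : s a = i
    · rw [dif_pos h, if_pos h]; exact F_pi_eq hX h _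
    · rw [dif_neg h, if_neg h]; simp

lemma refl_dim_eq [FiniteDimensional ℚ E] (hi : ∀ a, t a ≠ i)
    (hX : IsRp (rs s t i) (rt s t i) X)
    (hs : LinearMap.range (X.π i) ≤ LinearMap.range (Gm s i X)) :
    X.dim i + (refl hi hX).dim i = ∑ a, if s a = i then X.dim (t a) else 0 := by
  have h1 : (refl hi hX).dim i = Module.finrank ℚ (LinearMap.ker (Hmap s t i X)) := by
    unfold RD.dim
    rw [← finrank_map_inj (Ksub s t i X).subtype (Subtype.val_injective),
      ← finrank_map_inj (Pmap s t i X) Pmap_inj]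
    refine congrArg (fun p : Submodule ℚ (E × (A → E)) => Module.finrank ℚ p) ?_
    ext p
    constructor
    · rintro ⟨_, ⟨k, rfl⟩, rfl⟩
      refine ⟨fun a => ⟨k.1.2 a, ?_⟩, ?_, ?_⟩
      · by_cases h : s a = i
        · exact (mem_Usub_eq h _).mpr ⟨_, k.2.2.1 a h⟩
        · exact (mem_Usub_ne h _).mpr (k.2.2.2.1 a h)
      · change Hmap s t i X _ = 0
        rw [Hmap_apply]; exact k.2.2.2.2
      · rw [Submodule.subtype_apply, refl_pi, if_pos rfl]; rfl
    · rintro ⟨y, hy, rfl⟩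
      have hy' : Hmap s t i X y = 0 := hy
      rw [Hmap_apply] at hy'
      have hk : ((0, fun a => (y a).1) : E × (A → E)) ∈ Ksub s t i X := by
        refine ⟨by simp, fun a h => ?_, fun a h => (mem_Usub_ne h _).mp (y a).2, hy'⟩
        obtain ⟨z, hz⟩ := (mem_Usub_eq h _).mp (y a).2
        simp only
        rw [← hz, hX.idem]
      refine ⟨_, ⟨⟨_, hk⟩, rfl⟩, ?_⟩
      rw [Submodule.subtype_apply, refl_pi, if_pos rfl]; rfl
  have h2 : X.dim i = Module.finrank ℚ (LinearMap.range (Hmap s t i X)) := by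
    rw [range_Hmap hX hs]; rfl
  rw [h1, h2, LinearMap.finrank_range_add_finrank_ker, Module.finrank_pi_fintype]
  refine Finset.sum_congr rfl fun a _ => ?_
  unfold Usub RD.dim
  by_cases h : s a = i
  · rw [if_pos h, if_pos h]
  · rw [if_neg h, if_neg h]; exact finrank_bot ℚ E

lemma refl_dims [FiniteDimensional ℚ E] (hi : ∀ a, t a ≠ i)
    (hX : IsRp (rs s t i) (rt s t i) X)
    (hs : LinearMap.range (X.π i) ≤ LinearMap.range (Gm s i X)) (v : I → ℤ)
    (hd : ∀ j, (X.dim j : ℤ) = sig s t i v j) (j : I) : ((refl hi hX).dim j : ℤ) = v j := by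
  by_cases hj : j = i
  · subst hj
    have h := congrArg (fun n : ℕ => (n : ℤ)) (refl_dim_eq hi hX hs)
    simp only [Nat.cast_add, Nat.cast_sum, Nat.cast_ite, Nat.cast_zero, hd] at h
    have h2 := PP_sig (s := s) hi v
    unfold PP at h2
    rw [h2, sig_same] at h
    unfold PP at h
    linarith
  · rw [refl_dim_ne hi hX hj, hd, sig_ne _ _ _ _ hj]

lemma brick_surj [FiniteDimensional ℚ E] (hi : ∀ a, t a ≠ i)
    (hX : IsRp (rs s t i) (rt s t i) X) (h1 : Module.finrank ℚ (Hm X X) = 1) (v : I → ℤ)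
    (hd : ∀ j, (X.dim j : ℤ) = sig s t i v j) (hv : 0 ≤ v i) :
    LinearMap.range (X.π i) ≤ LinearMap.range (Gm s i X) := by
  rintro _ ⟨x0, rfl⟩
  by_contra hn
  obtain ⟨ξ, hξ, hker⟩ := Submodule.exists_le_ker_of_notMem hn
  let e : E →ₗ[ℚ] E := LinearMap.toSpanSingleton ℚ E (X.π i x0) ∘ₗ ξ ∘ₗ X.π i
  have he : ∀ x, e x = ξ (X.π i x) • X.π i x0 := fun x => rfl
  have hem : e ∈ Hm X X := by
    refine mem_Hm.mpr ⟨fun j x => ?_, fun a x => ?_⟩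
    · rw [he, he, map_smul]
      by_cases hj : j = i
      · subst hj; rw [hX.idem, hX.idem]
      · rw [hX.orth _ _ _ hj, hX.orth _ _ _ (Ne.symm hj)]; simp
    · rw [he, he, map_smul, F_pi_i hi hX, smul_zero]
      by_cases ha : s a = i
      · classical
        have hG : Gm s i X (Pi.single a x) = X.F a x := by
          rw [Gm_apply, Finset.sum_eq_single a]
          · simp [ha]
          · intro b _ hb; simp [hb]
          · simp
        have : ξ (X.F a x) = 0 := hker ⟨_, hG⟩
        rw [pi_F_eq hX ha, this, zero_smul]
      · rw [pi_F_ne hi hX ha]; simp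
  have hx0 : X.π i x0 ≠ 0 := by
    intro h; rw [h] at hξ; simp at hξ
  have hne : (⟨e, hem⟩ : Hm X X) ≠ 0 := by
    intro h
    have h2 : e x0 = 0 := by
      have := congrArg Subtype.val h
      exact LinearMap.congr_fun this x0
    rw [he] at h2
    exact (smul_ne_zero hξ hx0) h2
  have hid : (LinearMap.id : E →ₗ[ℚ] E) ∈ Hm X X :=
    mem_Hm.mpr ⟨fun j x => rfl, fun a x => rfl⟩
  obtain ⟨c, hc⟩ := (finrank_eq_one_iff_of_nonzero' _ hne).mp h1 ⟨_, hid⟩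
  have hc' : ∀ x, c • e x = x := by
    intro x
    exact LinearMap.congr_fun (congrArg Subtype.val hc) x
  have hz : ∀ j, j ≠ i → sig s t i v j = 0 := by
    intro j hj
    rw [← hd]
    have : X.π j = 0 := by
      apply LinearMap.ext
      intro x
      rw [← hc' (X.π j x), he, hX.orth _ _ _ (Ne.symm hj)]; simp
    unfold RD.dim
    rw [this, LinearMap.range_zero, finrank_bot]; rfl
  have hPP : PP s t i v = 0 := by
    rw [← PP_sig hi]
    unfold PP
    refine Finset.sum_eq_zero fun a _ => ?_
    rw [hz _ (hi a)]; simp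
  have hdi : X.dim i = 0 := by
    have := hd i
    rw [sig_same, hPP] at this
    omega
  unfold RD.dim at hdi
  rw [Submodule.finrank_eq_zero] at hdi
  apply hx0
  have : X.π i x0 ∈ LinearMap.range (X.π i) := ⟨x0, rfl⟩
  rw [hdi] at this
  simpa using this

lemma simple_pi (i j : I) (x : ℚ) : (simpleRp I A i).π j x = if j = i then x else 0 := by
  change (if j = i then LinearMap.id else 0 : ℚ →ₗ[ℚ] ℚ) x = _
  split_ifs <;> simp

lemma hom_simple_refl (hi : ∀ a, t a ≠ i) (hX : IsRp (rs s t i) (rt s t i) X) :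
    Module.finrank ℚ (Hm (simpleRp I A i) (refl hi hX)) = 0 := by
  have : Hm (simpleRp I A i) (refl hi hX) = ⊥ := by
    rw [eq_bot_iff]
    intro φ hφ
    obtain ⟨k1, k2⟩ := mem_Hm.mp hφ
    rw [Submodule.mem_bot]
    apply LinearMap.ext
    intro x
    have h1 := k1 i x
    rw [simple_pi, if_pos rfl] at h1
    have h1' := congrArg Subtype.val h1
    rw [refl_pi, if_pos rfl] at h1'
    apply Subtype.ext
    refine Prod.ext ((congrArg Prod.fst h1').trans rfl) ?_
    funext a
    by_cases ha : s a = i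
    · have h2 := congrArg Subtype.val (k2 a x)
      rw [refl_F, if_pos ha] at h2
      have h3 : φ ((simpleRp I A i).F a x) = 0 := by
        change φ ((0 : ℚ →ₗ[ℚ] ℚ) x) = 0
        simp
      rw [h3] at h2
      exact (congrArg Prod.fst h2).symm
    · exact (φ x).2.2.2.1 a ha
  rw [this, finrank_bot]

lemma hom_to_simple [FiniteDimensional ℚ E] (hi : ∀ a, t a ≠ i) (hX : IsRp s t X) :
    Module.finrank ℚ (Hm X (simpleRp I A i)) = X.dim i := by
  unfold RD.dim
  rw [← Subspace.dual_finrank_eq (K := ℚ) (V := LinearMap.range (X.π i))]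
  apply LinearEquiv.finrank_eq
  have hmem : ∀ f : Module.Dual ℚ (LinearMap.range (X.π i)),
      f ∘ₗ (X.π i).rangeRestrict ∈ Hm X (simpleRp I A i) := by
    intro f
    refine mem_Hm.mpr ⟨fun j x => ?_, fun a x => ?_⟩
    · rw [simple_pi]
      simp only [LinearMap.comp_apply]
      split_ifs with h
      · subst h
        congr 1
        exact Subtype.ext (hX.idem _ _)
      · have : (X.π i).rangeRestrict (X.π j x) = 0 :=
          Subtype.ext (hX.orth _ _ _ (Ne.symm h))
        rw [this, map_zero]
    · have : (X.π i).rangeRestrict (X.F a x) = 0 :=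
        Subtype.ext (hX.tgt_ne (hi a) _)
      simp only [LinearMap.comp_apply]
      rw [this, map_zero]
      rfl
  refine LinearEquiv.ofLinearMap
    { toFun := fun φ => φ.1 ∘ₗ (LinearMap.range (X.π i)).subtype
      map_add' := fun _ _ => rfl
      map_smul' := fun _ _ => rfl }
    { toFun := fun f => ⟨_, hmem f⟩
      map_add' := fun _ _ => rfl
      map_smul' := fun _ _ => rfl } ?_ ?_
  · apply LinearMap.ext
    intro f
    apply LinearMap.ext
    rintro ⟨_, x, rfl⟩
    change f ((X.π i).rangeRestrict (X.π i x)) = f _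
    congr 1
    exact Subtype.ext (hX.idem _ _)
  · apply LinearMap.ext
    rintro ⟨φ, hφ⟩
    apply Subtype.ext
    apply LinearMap.ext
    intro x
    change φ (X.π i x) = φ x
    rw [(mem_Hm.mp hφ).1, simple_pi, if_pos rfl]

lemma dies_eu : ∀ (L : List I) (s t : A → I) (v : I → ℤ), Adm L s t → Dies L s t v →
    eu s t v v = 1
  | [], _, _, _, _, h => h.elim
  | i :: L, s, t, v, ha, h => by
    obtain ⟨hi, ha⟩ := ha
    rcases h with rfl | ⟨_, h⟩
    · rw [eu_single_right hi]; simp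
    · rw [← eu_sig hi]
      exact dies_eu L _ _ _ ha h

/-- Bundled finite-dimensional representation data. -/
structure BR (I A : Type) where
  /-- total space -/
  E : Type
  /-- group structure -/
  [acg : AddCommGroup E]
  /-- module structure -/
  [mod : Module ℚ E]
  /-- finite dimensionality -/
  [fd : FiniteDimensional ℚ E]
  /-- data -/
  X : RD I A E

attribute [instance] BR.acg BR.mod BR.fd

lemma family : ∀ (L : List I) (s t : A → I), Adm L s t →
    ∃ V : (I → ℤ) → BR I A,
      (∀ v, Dies L s t v → IsRp s t (V v).X ∧ ∀ j, ((V v).X.dim j : ℤ) = v j) ∧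
      ∀ v w, Dies L s t v → Dies L s t w →
        (Module.finrank ℚ (Hm (V v).X (V w).X) : ℤ) = max 0 (eu s t v w)
  | [], _, _, _ => ⟨fun _ => ⟨ℚ, ⟨fun _ => 0, fun _ => 0⟩⟩, fun _ h => h.elim, fun _ _ h => h.elim⟩
  | i :: L, s, t, ha => by
    classical
    obtain ⟨hi, ha⟩ := ha
    obtain ⟨V, hV1, hV2⟩ := family L (rs s t i) (rt s t i) ha
    have key : ∀ v : I → ℤ, ∃ B : BR I A,
        (v = Pi.single i 1 → B = ⟨ℚ, simpleRp I A i⟩) ∧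
        (v ≠ Pi.single i 1 → ∀ h : IsRp (rs s t i) (rt s t i) (V (sig s t i v)).X,
          B = ⟨Ksub s t i (V (sig s t i v)).X, refl hi h⟩) := by
      intro v
      by_cases hv : v = Pi.single i 1
      · exact ⟨_, fun _ => rfl, fun h => absurd hv h⟩
      · by_cases h : IsRp (rs s t i) (rt s t i) (V (sig s t i v)).X
        · exact ⟨⟨Ksub s t i (V (sig s t i v)).X, refl hi h⟩, fun h => absurd h hv, fun _ _ => rfl⟩
        · exact ⟨⟨ℚ, simpleRp I A i⟩, fun h => absurd h hv, fun _ h' => absurd h' h⟩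
    choose W hW1 hW2 using key
    have hsurj : ∀ v, 0 ≤ v i → Dies L (rs s t i) (rt s t i) (sig s t i v) →
        LinearMap.range ((V (sig s t i v)).X.π i) ≤
          LinearMap.range (Gm s i (V (sig s t i v)).X) := by
      intro v h0 hd
      obtain ⟨q1, q2⟩ := hV1 _ hd
      refine brick_surj hi q1 ?_ v q2 h0
      have := hV2 _ _ hd hd
      rw [dies_eu L _ _ _ ha hd] at this
      simpa using this
    have hP1 : ∀ v, Dies (i :: L) s t v → IsRp s t (W v).X ∧ ∀ j, ((W v).X.dim j : ℤ) = v j := by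
      intro v hd
      by_cases hv : v = Pi.single i 1
      · rw [hW1 v hv, hv]
        exact ⟨simple_isRp s t i, simple_dim i⟩
      · rcases hd with hd | ⟨h0, hd⟩
        · exact absurd hd hv
        · obtain ⟨q1, q2⟩ := hV1 _ hd
          rw [hW2 v hv q1]
          exact ⟨refl_isRp hi q1, refl_dims hi q1 (hsurj v h0 hd) v q2⟩
    refine ⟨W, hP1, fun v w hdv hdw => ?_⟩
    by_cases hw : w = Pi.single i 1
    · obtain ⟨q1, q2⟩ := hP1 v hdv
      rw [hW1 w hw]
      have e1 := hom_to_simple hi q1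
      have e2 := q2 i
      simp only
      rw [e1, e2, hw, eu_single_right hi]
      omega
    · rcases hdw with hdw | ⟨h0w, hdw⟩
      · exact absurd hdw hw
      obtain ⟨q1, q2⟩ := hV1 _ hdw
      rw [hW2 w hw q1]
      by_cases hv : v = Pi.single i 1
      · rw [hW1 v hv]
        simp only
        rw [hom_simple_refl hi q1, hv, eu_single_left hi]
        have := q2 i
        rw [sig_same] at this
        omega
      · rcases hdv with hdv | ⟨h0v, hdv⟩
        · exact absurd hdv hv
        obtain ⟨p1, p2⟩ := hV1 _ hdv
        rw [hW2 v hv p1]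
        simp only
        rw [finrank_hom_refl hi p1 q1 (hsurj v h0v hdv), hV2 _ _ hdv hdw, eu_sig hi]

end Dims

section Final

set_option linter.unusedSectionVars false

variable {I A : Type} [Fintype I] [Fintype A] [DecidableEq I]
variable {E E' : Type} [AddCommGroup E] [Module ℚ E] [AddCommGroup E'] [Module ℚ E']
variable {s t : A → I} {W : RD I A E} {V : RD I A E'}

/-- Block-diagonal maps supported outside `I'`. -/
abbrev Blk (W : RD I A E) (V : RD I A E') (I' : Finset I) : Type :=
  ∀ j : {j // j ∉ I'}, LinearMap.range (W.π j.1) →ₗ[ℚ] LinearMap.range (V.π j.1)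

/-- Block-diagonal maps as maps of the total spaces. -/
def Tm (W : RD I A E) (V : RD I A E') (I' : Finset I) : Blk W V I' →ₗ[ℚ] (E →ₗ[ℚ] E') where
  toFun f := ∑ j, (LinearMap.range (V.π j.1)).subtype ∘ₗ f j ∘ₗ (W.π j.1).rangeRestrict
  map_add' f g := by
    rw [← Finset.sum_add_distrib]
    exact Finset.sum_congr rfl fun j _ => LinearMap.ext fun x => rfl
  map_smul' c f := by
    rw [Finset.smul_sum]
    exact Finset.sum_congr rfl fun j _ => LinearMap.ext fun x => rfl

lemma Tm_apply (I' : Finset I) (f : Blk W V I') (x : E) :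
    Tm W V I' f x = ∑ j, (f j ((W.π j.1).rangeRestrict x)).1 := by
  unfold Tm
  simp only [LinearMap.coe_mk, AddHom.coe_mk]
  rw [LinearMap.sum_apply]; rfl

lemma range_fix (hV : IsRp s t V) {j : I} (z : LinearMap.range (V.π j)) : V.π j z.1 = z.1 := by
  obtain ⟨_, y, rfl⟩ := z
  exact hV.idem _ _

lemma Tm_pi (hW : IsRp s t W) (hV : IsRp s t V) (I' : Finset I) (f : Blk W V I') (l : I) (x : E) :
    Tm W V I' f (W.π l x) = V.π l (Tm W V I' f x) := by
  rw [Tm_apply, Tm_apply, map_sum]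
  refine Finset.sum_congr rfl fun j _ => ?_
  by_cases h : j.1 = l
  · subst h
    rw [range_fix hV]
    congr 2
    exact Subtype.ext (hW.idem _ _)
  · have h1 : (W.π j.1).rangeRestrict (W.π l x) = 0 := Subtype.ext (hW.orth _ _ _ h)
    rw [h1, map_zero, ← range_fix hV (f j ((W.π j.1).rangeRestrict x)),
      hV.orth _ _ _ (Ne.symm h)]
    rfl

lemma Tm_pi_mem (hW : IsRp s t W) (I' : Finset I) (f : Blk W V I') {l : I}
    (hl : l ∈ I') (x : E) : Tm W V I' f (W.π l x) = 0 := by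
  rw [Tm_apply]
  refine Finset.sum_eq_zero fun j _ => ?_
  have h : j.1 ≠ l := by rintro rfl; exact j.2 hl
  have h1 : (W.π j.1).rangeRestrict (W.π l x) = 0 := Subtype.ext (hW.orth _ _ _ h)
  rw [h1, map_zero]; rfl

lemma Tm_inj (hW : IsRp s t W) (I' : Finset I) : Function.Injective (Tm W V I') := by
  rw [injective_iff_map_eq_zero]
  intro f hf
  funext l
  apply LinearMap.ext
  rintro ⟨_, x, rfl⟩
  have h := LinearMap.congr_fun hf (W.π l.1 x)
  rw [Tm_apply, Finset.sum_eq_single l] at h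
  · apply Subtype.ext
    have e : (W.π l.1).rangeRestrict (W.π l.1 x) = ⟨W.π l.1 x, x, rfl⟩ :=
      Subtype.ext (hW.idem _ _)
    rw [e] at h
    exact h
  · intro j _ hj
    have h1 : (W.π j.1).rangeRestrict (W.π l.1 x) = 0 :=
      Subtype.ext (hW.orth _ _ _ fun h => hj (Subtype.ext h))
    rw [h1, map_zero]; rfl
  · simp

/-- The defect of being a morphism along the arrows not inside `I'`. -/
def Dm (s t : A → I) (W : RD I A E) (V : RD I A E') (I' : Finset I) :
    Blk W V I' →ₗ[ℚ] (∀ a : {a // ¬ (s a ∈ I' ∧ t a ∈ I')},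
      LinearMap.range (W.π (s a.1)) →ₗ[ℚ] LinearMap.range (V.π (t a.1))) where
  toFun f a := (V.π (t a.1)).rangeRestrict ∘ₗ
    (Tm W V I' f ∘ₗ W.F a.1 - V.F a.1 ∘ₗ Tm W V I' f) ∘ₗ (LinearMap.range (W.π (s a.1))).subtype
  map_add' f g := by
    funext a
    apply LinearMap.ext
    intro x
    apply Subtype.ext
    simp only [map_add, LinearMap.comp_apply, LinearMap.sub_apply, Pi.add_apply,
      LinearMap.add_apply, map_sub, Submodule.coe_add, Submodule.coe_sub]
    abel
  map_smul' c f := by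
    funext a
    apply LinearMap.ext
    intro x
    apply Subtype.ext
    simp only [map_smul, LinearMap.comp_apply, LinearMap.sub_apply, Pi.smul_apply,
      LinearMap.smul_apply, map_sub, Submodule.coe_smul, Submodule.coe_sub, RingHom.id_apply,
      smul_sub]

lemma ker_Dm (hW : IsRp s t W) (hV : IsRp s t V) (I' : Finset I) (f : Blk W V I')
    (hf : Dm s t W V I' f = 0) : Tm W V I' f ∈ Hm W V := by
  refine mem_Hm.mpr ⟨Tm_pi hW hV I' f, fun a x => ?_⟩
  by_cases ha : s a ∈ I' ∧ t a ∈ I'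
  · rw [← hW.tgt, Tm_pi_mem hW I' f ha.2, ← hV.src, ← Tm_pi hW hV, Tm_pi_mem hW I' f ha.1,
      map_zero]
  · have h := congrArg Subtype.val
      (LinearMap.congr_fun (congrFun hf ⟨a, ha⟩) ⟨W.π (s a) x, x, rfl⟩)
    have h' : V.π (t a) (Tm W V I' f (W.F a (W.π (s a) x)) -
      V.F a (Tm W V I' f (W.π (s a) x))) = 0 := h
    rw [map_sub, hV.tgt, Tm_pi hW hV, hV.src, hW.src, ← Tm_pi hW hV, hW.tgt, sub_eq_zero] at h'
    exact h'

lemma final_ineq [FiniteDimensional ℚ E] [FiniteDimensional ℚ E'] (hW : IsRp s t W)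
    (hV : IsRp s t V) (I' : Finset I) :
    ∑ j : {j // j ∉ I'}, W.dim j.1 * V.dim j.1 ≤
      ∑ a : {a // ¬ (s a ∈ I' ∧ t a ∈ I')}, W.dim (s a.1) * V.dim (t a.1) +
        Module.finrank ℚ (Hm W V) := by
  have h1 := LinearMap.finrank_range_add_finrank_ker (Dm s t W V I')
  have h2 := Submodule.finrank_le (LinearMap.range (Dm s t W V I'))
  rw [Module.finrank_pi_fintype] at h1 h2
  simp only [Module.finrank_linearMap] at h1 h2
  let K : LinearMap.ker (Dm s t W V I') →ₗ[ℚ] Hm W V :=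
    (Tm W V I' ∘ₗ (LinearMap.ker (Dm s t W V I')).subtype).codRestrict (Hm W V)
      (fun f => ker_Dm hW hV I' f.1 f.2)
  have hK : Function.Injective K := by
    intro f g h
    apply Subtype.ext
    exact Tm_inj hW I' (congrArg Subtype.val h)
  have h3 := LinearMap.finrank_le_finrank_of_injective hK
  unfold RD.dim
  omega

lemma sum_sub {B : Type} [Fintype B] (p : B → Prop) [DecidablePred p] (f : B → ℤ) :
    ∑ b : {b // p b}, f b.1 = ∑ b, if p b then f b else 0 := by
  rw [← Finset.sum_filter]
  exact (Finset.sum_subtype (Finset.univ.filter p) (by simp) f).symm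

lemma eu_main {s t : A → I} (hNoLoops : ∀ a, s a ≠ t a)
    (hpos : ∀ v : I → ℝ, v ≠ 0 → 0 < eu s t v v)
    (v w : I → ℤ) (hv : ∀ j, 0 ≤ v j) (hv1 : eu s t v v = 1)
    (hw : ∀ j, 0 ≤ w j) (hw1 : eu s t w w = 1) (I' : Finset I) :
    -(eu s t (fun i => if i ∈ I' then w i else 0) (fun i => if i ∈ I' then v i else 0)) ≤
      max 0 (-(eu s t w v)) := by
  obtain ⟨L, hA, hLv, hLw⟩ := exists_dies hpos hNoLoops v w hv hv1 hw hw1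
  obtain ⟨V, hV1, hV2⟩ := family L s t hA
  obtain ⟨p1, p2⟩ := hV1 v hLv
  obtain ⟨q1, q2⟩ := hV1 w hLw
  have h := final_ineq q1 p1 I'
  zify at h
  simp only [p2, q2] at h
  rw [hV2 w v hLw hLv, sum_sub (fun j => j ∉ I') (fun j => w j * v j),
    sum_sub (fun a => ¬ (s a ∈ I' ∧ t a ∈ I')) (fun a => w (s a) * v (t a))] at h
  have e : eu s t w v = eu s t (fun i => if i ∈ I' then w i else 0)
      (fun i => if i ∈ I' then v i else 0) + ((∑ j, if j ∉ I' then w j * v j else 0) -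
      ∑ a, if ¬ (s a ∈ I' ∧ t a ∈ I') then w (s a) * v (t a) else 0) := by
    unfold eu
    have e1 : ∑ j, w j * v j = (∑ j, (if j ∈ I' then w j else 0) * (if j ∈ I' then v j else 0)) +
        ∑ j, if j ∉ I' then w j * v j else 0 := by
      rw [← Finset.sum_add_distrib]
      refine Finset.sum_congr rfl fun j _ => ?_
      by_cases hj : j ∈ I' <;> simp [hj]
    have e2 : ∑ a, w (s a) * v (t a) =
        (∑ a, (if s a ∈ I' then w (s a) else 0) * (if t a ∈ I' then v (t a) else 0)) +
        ∑ a, if ¬ (s a ∈ I' ∧ t a ∈ I') then w (s a) * v (t a) else 0 := by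
      rw [← Finset.sum_add_distrib]
      refine Finset.sum_congr rfl fun a _ => ?_
      by_cases h1 : s a ∈ I' <;> by_cases h2 : t a ∈ I' <;> simp [h1, h2]
    rw [e1, e2]; ring
  omega

end Final

/-- for positive roots `v, w` and a subset `I'` of the vertex set, letting
`v', w'` be obtained from `v, w` by replacing all coordinates outside `I'` by `0`,
we have `-⟨w',v'⟩ ≤ max(0, -⟨w,v⟩)`. -/
theorem stmt5
    (I A : Type) [Fintype I] [Fintype A] [DecidableEq I] (s t : A → I)
    (hNoLoops : ∀ a, s a ≠ t a)
    (hPosDef : ∀ v : I → ℝ, v ≠ 0 → 0 < eulerFormR s t v v + eulerFormR s t v v)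
    (v w : I → ℕ) (hv : IsPosRoot s t v) (hw : IsPosRoot s t w)
    (I' : Finset I)
    (v' w' : I → ℕ)
    (hv' : v' = fun i => if i ∈ I' then v i else 0)
    (hw' : w' = fun i => if i ∈ I' then w i else 0) :
    -(eulerN s t w' v') ≤ max 0 (-(eulerN s t w v)) := by
  subst hv' hw'
  have hpos : ∀ v : I → ℝ, v ≠ 0 → 0 < eu s t v v := by
    intro u hu
    have h := hPosDef u hu
    have h' : eulerFormR s t u u = eu s t u u := rfl
    rw [h'] at h
    linarith
  have h1 : ∀ u : I → ℕ, IsPosRoot s t u →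
      eu s t (fun i => (u i : ℤ)) (fun i => (u i : ℤ)) = 1 := by
    intro u hu
    have h := hu.2
    have h' : eulerN s t u u = eu s t (fun i => (u i : ℤ)) (fun i => (u i : ℤ)) := rfl
    rw [h'] at h
    omega
  have h := eu_main hNoLoops hpos (fun i => (v i : ℤ)) (fun i => (w i : ℤ))
    (fun j => Int.natCast_nonneg _) (h1 v hv) (fun j => Int.natCast_nonneg _) (h1 w hw) I'
  have e : ∀ u : I → ℕ, (fun i => (((if i ∈ I' then u i else 0 : ℕ)) : ℤ)) =
      fun i => if i ∈ I' then (u i : ℤ) else 0 := by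
    intro u; funext i; split_ifs <;> simp
  unfold eulerN
  rw [e, e]
  exact h

end ADEShuffle
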